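/- Let (G,w) be a weighted graph on n ≥ 2 vertices and let k ≥ 1 be an integer. If G does not contain a collection of k pairwise vertex-disjoint cycles of total weight at most ℓ, then the number of nontrivial paths of weight at most ℓ in G is at most n^{256k⁴} · n^{1024k⁵} = n^{256k⁴ + 1024k⁵}. -/

import Mathlib

open SimpleGraph

/-- A strict order on more than `r * s` elements has a chain of `r + 1` elements or an antichain
of more than `s` elements. -/
theorem exists_chain_or_antichain {α : Type*} (R : α → α → Prop)
    (htrans : ∀ x y z, R x y → R y z → R x z) (s : ℕ) :
    ∀ (r : ℕ) (S : Finset α), r * s < S.card →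
      (∃ f : ℕ → α, (∀ i ≤ r, f i ∈ S) ∧ ∀ i j, i < j → j ≤ r → R (f i) (f j)) ∨
      ∃ T ⊆ S, s < T.card ∧ ∀ x ∈ T, ∀ y ∈ T, ¬ R x y := by
  classical
  intro r
  induction r with
  | zero =>
    intro S hS
    obtain ⟨x, hx⟩ : S.Nonempty := Finset.card_pos.mp (by omega)
    exact Or.inl ⟨fun _ => x, fun _ _ => hx, fun i j hij hj => by omega⟩
  | succ r ih =>
    intro S hS
    set A := S.filter (fun x => ∀ y ∈ S, ¬ R y x) with hA
    by_cases hs : s < A.card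
    · exact Or.inr ⟨A, Finset.filter_subset _ _, hs, fun x hx y hy =>
        (Finset.mem_filter.mp hy).2 x (Finset.mem_filter.mp hx).1⟩
    · have hcard : r * s < (S \ A).card := by
        have hsub : (S \ A).card = S.card - A.card :=
          Finset.card_sdiff_of_subset (Finset.filter_subset _ _)
        rw [Nat.succ_mul] at hS
        omega
      rcases ih _ hcard with ⟨f, hf, hR⟩ | ⟨T, hT, h⟩
      · have h0 := Finset.mem_sdiff.mp (hf 0 (Nat.zero_le _))
        obtain ⟨y, hy, hy0⟩ : ∃ y ∈ S, R y (f 0) := by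
          by_contra! hcon
          exact h0.2 (Finset.mem_filter.mpr ⟨h0.1, hcon⟩)
        refine Or.inl ⟨fun i => if i = 0 then y else f (i - 1), fun i hi => ?_, fun i j hij hj => ?_⟩
        · by_cases h : i = 0
          · simpa [h] using hy
          · simpa [h] using (Finset.mem_sdiff.mp (hf (i - 1) (by omega))).1
        · have hj0 : j ≠ 0 := by omega
          by_cases h : i = 0
          · by_cases hj1 : j = 1
            · simpa [h, hj1] using hy0
            · simpa [h, hj0] using htrans _ _ _ hy0 (hR 0 (j - 1) (by omega) (by omega))
          · simpa [h, hj0] using hR (i - 1) (j - 1) (by omega) (by omega)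
      · exact Or.inr ⟨T, hT.trans Finset.sdiff_subset, h⟩

/-- Among sufficiently many chords `[lo c, hi c]` with pairwise distinct ends, there are `K` groups
with disjoint position sets `A i`, each consisting of one chord whose span lies in `A i`, or of two
chords whose lower ends, and whose upper ends, are joined within `A i`. -/
theorem exists_disjoint_chord_groups {ι : Type*} [Fintype ι] (K : ℕ) (lo hi : ι → ℕ)
    (hlt : ∀ c, lo c < hi c)
    (hlo : ∀ c d, c ≠ d → lo c ≠ lo d) (hhi : ∀ c d, c ≠ d → hi c ≠ hi d)
    (hlohi : ∀ c d, lo c ≠ hi d)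
    (hcard : K * (2 * K * (2 * K)) < Fintype.card ι) :
    ∃ (I : Fin K → Set ι) (A : Fin K → Set ℕ),
      (∀ i j, i ≠ j → Disjoint (A i) (A j)) ∧
      (∀ i j, i ≠ j → Disjoint (I i) (I j)) ∧
      (∀ i, ∀ c ∈ I i, lo c ∈ A i ∧ hi c ∈ A i) ∧
      ∀ i, (∃ c ∈ I i, Set.uIcc (lo c) (hi c) ⊆ A i) ∨
        ∃ c ∈ I i, ∃ d ∈ I i, c ≠ d ∧ Set.uIcc (lo c) (lo d) ⊆ A i ∧
          Set.uIcc (hi c) (hi d) ⊆ A i := by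
  classical
  rcases exists_chain_or_antichain (fun c d : ι => hi c < lo d)
    (fun x y z h1 h2 => h1.trans ((hlt y).trans h2)) _ K Finset.univ hcard with
    ⟨f, -, hf⟩ | ⟨T, -, hT, hTR⟩
  · refine ⟨fun i => {f i}, fun i => Set.Icc (lo (f i)) (hi (f i)), ?_, ?_, ?_, ?_⟩
    · intro i j hij
      rw [Set.disjoint_left]
      rintro x ⟨h1, h2⟩ ⟨h3, h4⟩
      rcases lt_or_gt_of_ne (Fin.val_ne_of_ne hij) with h | h
      · have := hf _ _ h (by omega); omega
      · have := hf _ _ h (by omega); omega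
    · intro i j hij
      rw [Set.disjoint_singleton]
      intro h'
      rcases lt_or_gt_of_ne (Fin.val_ne_of_ne hij) with h | h
      · have := hf _ _ h (by omega); have := hlt (f i); rw [h'] at *; omega
      · have := hf _ _ h (by omega); have := hlt (f i); rw [h'] at *; omega
    · rintro i c rfl
      have := hlt (f i)
      exact ⟨⟨le_rfl, this.le⟩, ⟨this.le, le_rfl⟩⟩
    · intro i
      exact Or.inl ⟨f i, rfl, by rw [Set.uIcc_of_le (hlt _).le]⟩
  · have key : ∃ f : ℕ → ι, (∀ i j, i < j → j ≤ 2 * K → lo (f i) < lo (f j) ∧ lo (f j) < hi (f i)) ∧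
        ((∀ i j, i < j → j ≤ 2 * K → hi (f i) < hi (f j)) ∨
          (∀ i j, i < j → j ≤ 2 * K → hi (f j) < hi (f i))) := by
      rcases exists_chain_or_antichain (fun c d : ι => lo c < lo d ∧ hi d < hi c)
        (fun x y z h1 h2 => ⟨h1.1.trans h2.1, h2.2.trans h1.2⟩) _ (2 * K) T hT with
        ⟨f, -, hf⟩ | ⟨T', hT'T, hT', hTR'⟩
      · refine ⟨f, fun i j hij hj => ⟨(hf i j hij hj).1, ?_⟩,
          Or.inr fun i j hij hj => (hf i j hij hj).2⟩
        exact (hlt _).trans (hf i j hij hj).2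
      · rcases exists_chain_or_antichain (fun c d : ι => lo c < lo d)
          (fun x y z h1 h2 => h1.trans h2) 1 (2 * K) T' (by omega) with
          ⟨f, hfT, hf⟩ | ⟨T'', -, hc, hR⟩
        · have hne : ∀ i j, i < j → j ≤ 2 * K → f i ≠ f j := fun i j hij hj h => by
            have := hf i j hij hj; rw [h] at this; omega
          refine ⟨f, fun i j hij hj => ⟨hf i j hij hj, ?_⟩, Or.inl fun i j hij hj => ?_⟩
          · have := hTR _ (hT'T (hfT i (by omega))) _ (hT'T (hfT j hj))
            have := hlohi (f j) (f i)
            omega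
          · have := hTR' _ (hfT i (by omega)) _ (hfT j hj)
            have := hhi _ _ (hne i j hij hj)
            have := hf i j hij hj
            omega
        · obtain ⟨x, hx, y, hy, hxy⟩ := Finset.one_lt_card.mp hc
          have := hR x hx y hy
          have := hR y hy x hx
          have := hlo x y hxy
          omega
    obtain ⟨f, hf, hmono⟩ := key
    have hinj : ∀ i j, i ≤ 2 * K → j ≤ 2 * K → f i = f j → i = j := by
      intro i j hi' hj' h
      rcases lt_trichotomy i j with h' | h' | h'
      · have := (hf i j h' hj').1; rw [h] at this; omega
      · exact h'
      · have := (hf j i h' hi').1; rw [h] at this; omega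
    refine ⟨fun i => {f (2 * i), f (2 * i + 1)},
      fun i => Set.Icc (lo (f (2 * i))) (lo (f (2 * i + 1))) ∪
        Set.uIcc (hi (f (2 * i))) (hi (f (2 * i + 1))), ?_, ?_, ?_, ?_⟩
    · have aux : ∀ i j : Fin K, (i : ℕ) < j → Disjoint
          (Set.Icc (lo (f (2 * i))) (lo (f (2 * i + 1))) ∪
            Set.uIcc (hi (f (2 * i))) (hi (f (2 * i + 1))))
          (Set.Icc (lo (f (2 * j))) (lo (f (2 * j + 1))) ∪
            Set.uIcc (hi (f (2 * j))) (hi (f (2 * j + 1)))) := by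
        intro i j hij
        rw [Set.disjoint_left]
        have h1 := hf (2 * i) (2 * i + 1) (by omega) (by omega)
        have h2 := hf (2 * i + 1) (2 * j) (by omega) (by omega)
        have h3 := hf (2 * j) (2 * j + 1) (by omega) (by omega)
        have h4 := hf (2 * i) (2 * j + 1) (by omega) (by omega)
        have h5 := hf (2 * i + 1) (2 * j + 1) (by omega) (by omega)
        have h6 := hlt (f (2 * i + 1))
        have h7 := hlt (f (2 * j + 1))
        rcases hmono with hm | hm
        · have g1 := hm (2 * i) (2 * i + 1) (by omega) (by omega)
          have g2 := hm (2 * i + 1) (2 * j) (by omega) (by omega)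
          have g3 := hm (2 * j) (2 * j + 1) (by omega) (by omega)
          intro x hx hy
          rw [Set.uIcc_of_le g1.le, Set.mem_union, Set.mem_Icc, Set.mem_Icc] at hx
          rw [Set.uIcc_of_le g3.le, Set.mem_union, Set.mem_Icc, Set.mem_Icc] at hy
          omega
        · have g1 := hm (2 * i) (2 * i + 1) (by omega) (by omega)
          have g2 := hm (2 * i + 1) (2 * j) (by omega) (by omega)
          have g3 := hm (2 * j) (2 * j + 1) (by omega) (by omega)
          intro x hx hy
          rw [Set.uIcc_of_ge g1.le, Set.mem_union, Set.mem_Icc, Set.mem_Icc] at hx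
          rw [Set.uIcc_of_ge g3.le, Set.mem_union, Set.mem_Icc, Set.mem_Icc] at hy
          omega
      intro i j hij
      rcases lt_or_gt_of_ne (Fin.val_ne_of_ne hij) with h | h
      · exact aux i j h
      · exact (aux j i h).symm
    · intro i j hij
      have := Fin.val_ne_of_ne hij
      rw [Set.disjoint_left]
      rintro x (rfl | rfl) (h | h)
      all_goals have := hinj _ _ (by omega) (by omega) h; omega
    · have h1 : ∀ i : Fin K, lo (f (2 * i)) ≤ lo (f (2 * i + 1)) :=
        fun i => (hf (2 * i) (2 * i + 1) (by omega) (by omega)).1.le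
      rintro i c (rfl | rfl)
      · exact ⟨Or.inl ⟨le_rfl, h1 i⟩, Or.inr Set.left_mem_uIcc⟩
      · exact ⟨Or.inl ⟨h1 i, le_rfl⟩, Or.inr Set.right_mem_uIcc⟩
    · intro i
      have h1 := (hf (2 * i) (2 * i + 1) (by omega) (by omega)).1
      refine Or.inr ⟨f (2 * i), Or.inl rfl, f (2 * i + 1), Or.inr rfl, fun h => ?_, ?_,
        Set.subset_union_right⟩
      · rw [h] at h1; omega
      · rw [Set.uIcc_of_le h1.le]; exact Set.subset_union_left

/-- If the ends of an edge `s(u, v)` in `E` are joined within `E` avoiding that edge, then `E`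
contains a cycle. -/
theorem exists_cycle_of_reachable {V : Type*} {G : SimpleGraph V} {E : Set (Sym2 V)}
    (hE : E ⊆ G.edgeSet) {u v : V} (huv : s(u, v) ∈ E)
    (hr : (fromEdgeSet (E \ {s(u, v)})).Reachable u v) :
    ∃ (x : V) (D : G.Walk x x), D.IsCycle ∧ ∀ e ∈ D.edges, e ∈ E := by
  have hle : fromEdgeSet E ≤ G := by
    intro a b hab
    exact hE ((fromEdgeSet_adj _).mp hab).1
  have hadj : (fromEdgeSet E).Adj u v :=
    (fromEdgeSet_adj _).mpr ⟨huv, (show G.Adj u v from hE huv).ne⟩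
  have hr' : ((fromEdgeSet E).deleteEdges {s(u, v)}).Reachable u v := by
    refine hr.mono ?_
    intro a b hab
    rw [fromEdgeSet_adj] at hab
    rw [deleteEdges_adj, fromEdgeSet_adj]
    exact ⟨⟨hab.1.1, hab.2⟩, hab.1.2⟩
  obtain ⟨x, D, hD, -⟩ := adj_and_reachable_delete_edges_iff_exists_cycle.mp ⟨hadj, hr'⟩
  refine ⟨x, D.mapLe hle, hD.mapLe hle, fun e he => ?_⟩
  rw [Walk.edges_mapLe_eq_edges] at he
  have := D.edges_subset_edgeSet he
  rw [edgeSet_fromEdgeSet] at this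
  exact this.1

/-- Consecutive adjacency along a sequence gives reachability between its terms. -/
theorem reachable_of_uIcc {V : Type*} {H : SimpleGraph V} (q : ℕ → V) (i j : ℕ)
    (h : ∀ m, min i j ≤ m → m < max i j → H.Adj (q m) (q (m + 1))) :
    H.Reachable (q i) (q j) := by
  wlog hij : i ≤ j generalizing i j
  · exact (this j i (fun m h1 h2 => h m (by omega) (by omega)) (by omega)).symm
  induction j, hij using Nat.le_induction with
  | base => exact Reachable.refl _
  | succ j hij ih =>
    exact (ih fun m h1 h2 => h m (by omega) (by omega)).trans
      (h j (by omega) (by omega)).reachable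

/-- Two vertex sequences `p`, `q` of paths in `G`, of lengths `L` and `M`, with excursions
`[σ c, τ c]` of the first path from the second: pairwise disjoint index intervals with both ends,
but no interior vertex, on the second path, and whose first edge is not an edge of the second
path.  The ends of the excursion `c` sit at the positions `lo c` and `hi c` of the second path. -/
structure ExcursionSystem {V : Type*} (G : SimpleGraph V) (p q : ℕ → V) (L M : ℕ)
    {ι : Type*} (σ τ lo hi : ι → ℕ) : Prop where
  injOn_p : Set.InjOn p {i | i ≤ L}
  injOn_q : Set.InjOn q {i | i ≤ M}
  adj_p : ∀ i < L, G.Adj (p i) (p (i + 1))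
  adj_q : ∀ i < M, G.Adj (q i) (q (i + 1))
  lt : ∀ c, σ c < τ c
  le_length : ∀ c, τ c ≤ L
  separated : ∀ c d, c ≠ d → τ c < σ d ∨ τ d < σ c
  interior : ∀ c m, σ c < m → m < τ c → ∀ j ≤ M, p m ≠ q j
  first_edge : ∀ c, ∀ j < M, s(p (σ c), p (σ c + 1)) ≠ s(q j, q (j + 1))
  lo_lt_hi : ∀ c, lo c < hi c
  hi_le : ∀ c, hi c ≤ M
  ends : ∀ c, (p (σ c) = q (lo c) ∧ p (τ c) = q (hi c)) ∨
    (p (σ c) = q (hi c) ∧ p (τ c) = q (lo c))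

namespace ExcursionSystem

variable {V : Type*} {G : SimpleGraph V} {p q : ℕ → V} {L M : ℕ} {ι : Type*} {σ τ lo hi : ι → ℕ}

/-- The edges of the first path inside the excursions in `I` and of the second path inside `A`. -/
def regionEdges (p q : ℕ → V) (L M : ℕ) (σ τ : ι → ℕ) (I : Set ι) (A : Set ℕ) : Set (Sym2 V) :=
  {e | (∃ m < M, m ∈ A ∧ m + 1 ∈ A ∧ e = s(q m, q (m + 1))) ∨
    ∃ c ∈ I, ∃ m < L, σ c ≤ m ∧ m < τ c ∧ e = s(p m, p (m + 1))}

theorem step_inj (h : ExcursionSystem G p q L M σ τ lo hi) {m n : ℕ} (hm : m < L) (hn : n < L)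
    (he : s(p m, p (m + 1)) = s(p n, p (n + 1))) : m = n := by
  rw [Sym2.eq_iff] at he
  rcases he with ⟨h1, -⟩ | ⟨h1, h2⟩
  · exact h.injOn_p hm.le hn.le h1
  · have e1 := h.injOn_p (show m ≤ L by omega) (show n + 1 ≤ L by omega) h1
    have e2 := h.injOn_p (show m + 1 ≤ L by omega) (show n ≤ L by omega) h2
    omega

theorem regionEdges_subset (h : ExcursionSystem G p q L M σ τ lo hi) (I : Set ι) (A : Set ℕ) :
    regionEdges p q L M σ τ I A ⊆ G.edgeSet := by
  rintro e (⟨m, hm, -, -, rfl⟩ | ⟨c, -, m, hm, -, -, rfl⟩)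
  · exact h.adj_q m hm
  · exact h.adj_p m hm

theorem ends_mem (h : ExcursionSystem G p q L M σ τ lo hi) {m : ℕ} {c : ι} (h1 : σ c ≤ m)
    (h2 : m ≤ τ c) {j : ℕ} (hj : j ≤ M) (hpq : p m = q j) : j = lo c ∨ j = hi c := by
  have hlo : lo c ≤ M := (h.lo_lt_hi c).le.trans (h.hi_le c)
  have : m = σ c ∨ m = τ c := by
    by_contra! hne
    exact h.interior c m (by omega) (by omega) j hj hpq
  rcases this with rfl | rfl <;> rcases h.ends c with ⟨e1, e2⟩ | ⟨e1, e2⟩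
  · exact Or.inl (h.injOn_q hj hlo (hpq.symm.trans e1))
  · exact Or.inr (h.injOn_q hj (h.hi_le c) (hpq.symm.trans e1))
  · exact Or.inr (h.injOn_q hj (h.hi_le c) (hpq.symm.trans e2))
  · exact Or.inl (h.injOn_q hj hlo (hpq.symm.trans e2))

theorem regionEdges_vertex_disjoint (h : ExcursionSystem G p q L M σ τ lo hi) {I J : Set ι}
    {A B : Set ℕ} (hIJ : Disjoint I J) (hAB : Disjoint A B)
    (hA : ∀ c ∈ I, lo c ∈ A ∧ hi c ∈ A) (hB : ∀ c ∈ J, lo c ∈ B ∧ hi c ∈ B)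
    {e f : Sym2 V} (he : e ∈ regionEdges p q L M σ τ I A)
    (hf : f ∈ regionEdges p q L M σ τ J B) {x : V} (hxe : x ∈ e) : x ∉ f := by
  have vert : ∀ {I : Set ι} {A : Set ℕ} {e : Sym2 V}, e ∈ regionEdges p q L M σ τ I A →
      ∀ x ∈ e, (∃ m ≤ M, m ∈ A ∧ x = q m) ∨
        ∃ c ∈ I, ∃ m ≤ L, σ c ≤ m ∧ m ≤ τ c ∧ x = p m := by
    rintro I A e (⟨m, hm, h1, h2, rfl⟩ | ⟨c, hc, m, hm, h1, h2, rfl⟩) x hx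
    · rcases Sym2.mem_iff.mp hx with rfl | rfl
      · exact Or.inl ⟨m, hm.le, h1, rfl⟩
      · exact Or.inl ⟨m + 1, hm, h2, rfl⟩
    · rcases Sym2.mem_iff.mp hx with rfl | rfl
      · exact Or.inr ⟨c, hc, m, hm.le, h1, h2.le, rfl⟩
      · exact Or.inr ⟨c, hc, m + 1, hm, by omega, h2, rfl⟩
  rw [Set.disjoint_left] at hIJ hAB
  intro hxf
  rcases vert he x hxe with ⟨m, hm, hmA, rfl⟩ | ⟨c, hc, m, hm, h1, h2, rfl⟩ <;>
    rcases vert hf _ hxf with ⟨n, hn, hnB, hx⟩ | ⟨d, hd, n, hn, h3, h4, hx⟩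
  · exact hAB hmA (h.injOn_q hm hn hx ▸ hnB)
  · rcases h.ends_mem h3 h4 hm hx.symm with rfl | rfl
    · exact hAB hmA (hB d hd).1
    · exact hAB hmA (hB d hd).2
  · rcases h.ends_mem h1 h2 hn hx with rfl | rfl
    · exact hAB (hA c hc).1 hnB
    · exact hAB (hA c hc).2 hnB
  · have hmn := h.injOn_p hm hn hx
    have hcd : c ≠ d := fun hcd => hIJ hc (hcd ▸ hd)
    rcases h.separated c d hcd with h' | h' <;> omega

theorem exists_cycle (h : ExcursionSystem G p q L M σ τ lo hi) {I : Set ι} {A : Set ℕ}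
    (hIA : (∃ c ∈ I, Set.uIcc (lo c) (hi c) ⊆ A) ∨
      ∃ c ∈ I, ∃ d ∈ I, c ≠ d ∧ Set.uIcc (lo c) (lo d) ⊆ A ∧ Set.uIcc (hi c) (hi d) ⊆ A) :
    ∃ (x : V) (D : G.Walk x x), D.IsCycle ∧
      ∀ e ∈ D.edges, e ∈ regionEdges p q L M σ τ I A := by
  have hloM : ∀ c, lo c ≤ M := fun c => (h.lo_lt_hi c).le.trans (h.hi_le c)
  obtain ⟨c, hc, hred⟩ : ∃ c ∈ I, (fromEdgeSet (regionEdges p q L M σ τ I A \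
      {s(p (σ c), p (σ c + 1))})).Reachable (q (lo c)) (q (hi c)) := by
    have hQ : ∀ c i j, i ≤ M → j ≤ M → Set.uIcc i j ⊆ A → (fromEdgeSet
        (regionEdges p q L M σ τ I A \ {s(p (σ c), p (σ c + 1))})).Reachable (q i) (q j) := by
      intro c i j hi' hj' hij
      refine reachable_of_uIcc q i j fun m h1 h2 => ?_
      rw [fromEdgeSet_adj]
      have hm : m < M := by omega
      refine ⟨⟨Or.inl ⟨m, hm, hij ⟨h1, h2.le⟩, hij ⟨by omega, by omega⟩, rfl⟩, ?_⟩,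
        (h.adj_q m hm).ne⟩
      exact (h.first_edge c m hm).symm
    rcases hIA with ⟨c, hc, hA⟩ | ⟨c, hc, d, hd, hcd, hA1, hA2⟩
    · exact ⟨c, hc, hQ c _ _ (hloM c) (h.hi_le c) hA⟩
    · refine ⟨c, hc, (hQ c _ _ (hloM c) (hloM d) hA1).trans (Reachable.trans ?_
        (hQ c _ _ (h.hi_le c) (h.hi_le d) hA2).symm)⟩
      have hd' : (fromEdgeSet (regionEdges p q L M σ τ I A \
          {s(p (σ c), p (σ c + 1))})).Reachable (p (σ d)) (p (τ d)) := by
        refine reachable_of_uIcc p _ _ fun m h1 h2 => ?_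
        have := h.lt d
        have := h.lt c
        have := h.le_length d
        have := h.le_length c
        have hsep := h.separated c d hcd
        rw [fromEdgeSet_adj]
        refine ⟨⟨Or.inr ⟨d, hd, m, by omega, by omega, by omega, rfl⟩, fun he => ?_⟩,
          (h.adj_p m (by omega)).ne⟩
        have := h.step_inj (by omega) (by omega) he
        omega
      rcases h.ends d with ⟨e1, e2⟩ | ⟨e1, e2⟩
      · rwa [e1, e2] at hd'
      · rw [e1, e2] at hd'
        exact hd'.symm
  have h1 := h.lt c
  have h2 := h.le_length c
  refine exists_cycle_of_reachable (h.regionEdges_subset I A) (u := p (σ c)) (v := p (σ c + 1))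
    (Or.inr ⟨c, hc, σ c, by omega, le_rfl, h1, rfl⟩) ?_
  have hst : (fromEdgeSet (regionEdges p q L M σ τ I A \
      {s(p (σ c), p (σ c + 1))})).Reachable (p (σ c)) (p (τ c)) := by
    rcases h.ends c with ⟨e1, e2⟩ | ⟨e1, e2⟩
    · rw [← e1, ← e2] at hred
      exact hred
    · rw [← e1, ← e2] at hred
      exact hred.symm
  refine hst.trans (Reachable.symm ?_)
  refine reachable_of_uIcc p _ _ fun m h3 h4 => ?_
  rw [fromEdgeSet_adj]
  refine ⟨⟨Or.inr ⟨c, hc, m, by omega, by omega, by omega, rfl⟩, fun he => ?_⟩,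
    (h.adj_p m (by omega)).ne⟩
  have := h.step_inj (by omega) (by omega) he
  omega

/-- Many excursions yield `K` vertex-disjoint cycles within the union of the two paths. -/
theorem exists_disjoint_cycles [Fintype ι] (h : ExcursionSystem G p q L M σ τ lo hi) (K : ℕ)
    (hcard : K * (2 * K * (2 * K)) < Fintype.card ι) :
    ∃ (v : Fin K → V) (D : (i : Fin K) → G.Walk (v i) (v i)), (∀ i, (D i).IsCycle) ∧
      (∀ i j, i ≠ j → ∀ x, x ∈ (D i).support → x ∉ (D j).support) ∧
      ∀ i, ∀ e ∈ (D i).edges,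
        (∃ m < L, e = s(p m, p (m + 1))) ∨ ∃ m < M, e = s(q m, q (m + 1)) := by
  have hloM : ∀ c, lo c ≤ M := fun c => (h.lo_lt_hi c).le.trans (h.hi_le c)
  have hends : ∀ c d j, j ≤ M → (j = lo c ∨ j = hi c) → (j = lo d ∨ j = hi d) → c = d := by
    intro c d j hj hc hd
    have aux : ∀ c, (j = lo c ∨ j = hi c) → ∃ m, (m = σ c ∨ m = τ c) ∧ p m = q j := by
      rintro c (rfl | rfl) <;> rcases h.ends c with ⟨e1, e2⟩ | ⟨e1, e2⟩
      exacts [⟨_, Or.inl rfl, e1⟩, ⟨_, Or.inr rfl, e2⟩, ⟨_, Or.inr rfl, e2⟩, ⟨_, Or.inl rfl, e1⟩]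
    obtain ⟨m, hm, em⟩ := aux c hc
    obtain ⟨n, hn, en⟩ := aux d hd
    have := h.lt c
    have := h.lt d
    have := h.le_length c
    have := h.le_length d
    have hmn := h.injOn_p (show m ≤ L by omega) (show n ≤ L by omega) (em.trans en.symm)
    by_contra hcd
    rcases h.separated c d hcd with h' | h' <;> omega
  obtain ⟨I, A, hA, hI, hIA, hcyc⟩ := exists_disjoint_chord_groups K lo hi h.lo_lt_hi
    (fun c d hcd he => hcd (hends c d (lo c) (hloM c) (Or.inl rfl) (Or.inl he)))
    (fun c d hcd he => hcd (hends c d (hi c) (h.hi_le c) (Or.inr rfl) (Or.inr he)))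
    (fun c d he => by
      have := hends c d (lo c) (hloM c) (Or.inl rfl) (Or.inr he)
      subst this
      exact (h.lo_lt_hi c).ne he)
    hcard
  choose v D hD hDe using fun i => h.exists_cycle (hcyc i)
  refine ⟨v, D, hD, fun i j hij x hxi hxj => ?_, fun i e he => ?_⟩
  · rw [Walk.mem_support_iff_exists_mem_edges_of_not_nil (hD i).not_nil] at hxi
    rw [Walk.mem_support_iff_exists_mem_edges_of_not_nil (hD j).not_nil] at hxj
    obtain ⟨e, he, hxe⟩ := hxi
    obtain ⟨f, hf, hxf⟩ := hxj
    exact h.regionEdges_vertex_disjoint (hI i j hij) (hA i j hij) (hIA i) (hIA j)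
      (hDe i e he) (hDe j f hf) hxe hxf
  · rcases hDe i e he with ⟨m, hm, -, -, rfl⟩ | ⟨c, -, m, hm, -, -, rfl⟩
    · exact Or.inr ⟨m, hm, rfl⟩
    · exact Or.inl ⟨m, hm, rfl⟩

end ExcursionSystem

/-- If the path `P` leaves the path `Q` along a non-edge of `Q` often enough, then the union of the
two paths contains `K` vertex-disjoint cycles. -/
theorem exists_disjoint_cycles_of_exits {V : Type*} {G : SimpleGraph V} {a b c d : V}
    {P : G.Walk a b} (hP : P.IsPath) {Q : G.Walk c d} (hQ : Q.IsPath) (K : ℕ) (O : Finset ℕ)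
    (hO : ∀ s ∈ O, s < P.length ∧ P.getVert s ∈ Q.support ∧
      s(P.getVert s, P.getVert (s + 1)) ∉ Q.edges)
    (hcard : 8 * K ^ 3 + 2 ≤ O.card) :
    ∃ (v : Fin K → V) (D : (i : Fin K) → G.Walk (v i) (v i)), (∀ i, (D i).IsCycle) ∧
      (∀ i j, i ≠ j → ∀ x, x ∈ (D i).support → x ∉ (D j).support) ∧
      ∀ i, ∀ e ∈ (D i).edges, e ∈ P.edges ∨ e ∈ Q.edges := by
  classical
  have hedge : ∀ {a b : V} (W : G.Walk a b) (m : ℕ), m < W.length →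
      s(W.getVert m, W.getVert (m + 1)) ∈ W.edges := fun W m hm => by
    have hm' : m < W.edges.length := by simpa using hm
    rw [← Walk.getElem_edges hm']
    exact List.getElem_mem hm'
  let o := O.orderEmbOfCardLe hcard
  have ho : ∀ i, o i ∈ O := fun i => O.orderEmbOfCardLe_mem hcard i
  let first : Fin (4 * K ^ 3 + 1) → Fin (8 * K ^ 3 + 2) := fun i => ⟨2 * i, by omega⟩
  let second : Fin (4 * K ^ 3 + 1) → Fin (8 * K ^ 3 + 2) := fun i => ⟨2 * i + 1, by omega⟩
  have hfs : ∀ i, o (first i) < o (second i) := fun i => o.lt_iff_lt.mpr (by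
    simp [first, second, Fin.lt_def])
  have hsf : ∀ i j, i < j → o (second i) < o (first j) := fun i j hij => o.lt_iff_lt.mpr (by
    simp only [first, second, Fin.lt_def] at hij ⊢; omega)
  have hex : ∀ i, ∃ t, o (first i) < t ∧ P.getVert t ∈ Q.support := fun i =>
    ⟨o (second i), hfs i, (hO _ (ho _)).2.1⟩
  let τ := fun i => Nat.find (hex i)
  have hτ : ∀ i, o (first i) < τ i ∧ P.getVert (τ i) ∈ Q.support := fun i => Nat.find_spec (hex i)
  have hτs : ∀ i, τ i ≤ o (second i) := fun i => Nat.find_min' (hex i) ⟨hfs i, (hO _ (ho _)).2.1⟩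
  have hpos : ∀ t, P.getVert t ∈ Q.support → ∃ n, Q.getVert n = P.getVert t ∧ n ≤ Q.length :=
    fun t ht => Walk.mem_support_iff_exists_getVert.mp ht
  choose α hα hαl using fun i => hpos _ (hO _ (ho (first i))).2.1
  choose β hβ hβl using fun i => hpos _ (hτ i).2
  have hτL : ∀ i, τ i ≤ P.length := fun i => (hτs i).trans (hO _ (ho _)).1.le
  have hαβ : ∀ i, α i ≠ β i := fun i h => by
    have h1 := hα i
    rw [h, hβ i] at h1
    have h2 := (hτ i).1
    have := hP.getVert_injOn (hτL i) (show o (first i) ≤ P.length from (h2.le.trans (hτL i))) h1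
    omega
  have hsys : ExcursionSystem G P.getVert Q.getVert P.length Q.length (fun i => o (first i)) τ
      (fun i => min (α i) (β i)) (fun i => max (α i) (β i)) :=
    { injOn_p := hP.getVert_injOn
      injOn_q := hQ.getVert_injOn
      adj_p := fun i hi => P.adj_getVert_succ hi
      adj_q := fun i hi => Q.adj_getVert_succ hi
      lt := fun i => (hτ i).1
      le_length := hτL
      separated := fun i j hij => by
        rcases lt_or_gt_of_ne hij with h | h
        · exact Or.inl ((hτs i).trans_lt (hsf i j h))
        · exact Or.inr ((hτs j).trans_lt (hsf j i h))
      interior := fun i m h1 h2 j hj he =>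
        Nat.find_min (hex i) h2 ⟨h1, he ▸ Q.getVert_mem_support j⟩
      first_edge := fun i j hj he => (hO _ (ho (first i))).2.2 (he ▸ hedge Q j hj)
      lo_lt_hi := fun i => by have := hαβ i; omega
      hi_le := fun i => max_le (hαl i) (hβl i)
      ends := fun i => by
        rcases le_total (α i) (β i) with h | h
        · rw [min_eq_left h, max_eq_right h]; exact Or.inl ⟨(hα i).symm, (hβ i).symm⟩
        · rw [min_eq_right h, max_eq_left h]; exact Or.inr ⟨(hα i).symm, (hβ i).symm⟩ }
  obtain ⟨v, D, hD, hdisj, he⟩ := hsys.exists_disjoint_cycles K (by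
    rw [Fintype.card_fin]; ring_nf; omega)
  refine ⟨v, D, hD, hdisj, fun i e hei => ?_⟩
  rcases he i e hei with ⟨m, hm, rfl⟩ | ⟨m, hm, rfl⟩
  · exact Or.inl (hedge P m hm)
  · exact Or.inr (hedge Q m hm)

/-- The total weight of vertex-disjoint cycles in the union of two paths is at most the total
weight of the two paths. -/
theorem sum_weight_cycles_le {V : Type*} [DecidableEq V] {G : SimpleGraph V} (w : Sym2 V → ℕ)
    {a b c d : V} {P : G.Walk a b} (hP : P.IsPath) {Q : G.Walk c d} (hQ : Q.IsPath) {K : ℕ}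
    {v : Fin K → V} {D : (i : Fin K) → G.Walk (v i) (v i)} (hD : ∀ i, (D i).IsCycle)
    (hdisj : ∀ i j, i ≠ j → ∀ x, x ∈ (D i).support → x ∉ (D j).support)
    (hE : ∀ i, ∀ e ∈ (D i).edges, e ∈ P.edges ∨ e ∈ Q.edges) :
    ∑ i, ((D i).edges.map w).sum ≤ (P.edges.map w).sum + (Q.edges.map w).sum := by
  have h1 : ∀ i, ((D i).edges.map w).sum = ∑ e ∈ (D i).edges.toFinset, w e := fun i =>
    (List.sum_toFinset w (hD i).isCircuit.isTrail.edges_nodup).symm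
  rw [← List.sum_toFinset w hP.isTrail.edges_nodup, ← List.sum_toFinset w hQ.isTrail.edges_nodup,
    Finset.sum_congr rfl fun i _ => h1 i, ← Finset.sum_biUnion, ← Finset.sum_union_inter]
  · refine le_trans (Finset.sum_le_sum_of_subset fun e he => ?_) (Nat.le_add_right _ _)
    obtain ⟨i, -, hi⟩ := Finset.mem_biUnion.mp he
    simpa using hE i e (by simpa using hi)
  · intro i _ j _ hij
    rw [Function.onFun, Finset.disjoint_left]
    intro e hi hj
    rw [List.mem_toFinset] at hi hj
    induction e with
    | h x y =>
      exact hdisj i j hij x ((D i).fst_mem_support_of_mem_edges hi)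
        ((D j).fst_mem_support_of_mem_edges hj)

/-- If `G` has no `k` vertex-disjoint cycles of total weight at most `ℓ`, then a path of weight at
most `ℓ` leaves another such path a bounded number of times. -/
theorem card_exits_le {V : Type*} [DecidableEq V] {G : SimpleGraph V} (w : Sym2 V → ℕ) {k ℓ : ℕ}
    (hno : ¬ ∃ (v : Fin k → V) (D : (i : Fin k) → G.Walk (v i) (v i)),
      (∀ i, (D i).IsCycle) ∧
      (∀ i j, i ≠ j → ∀ x, x ∈ (D i).support → x ∉ (D j).support) ∧
      (∑ i, ((D i).edges.map w).sum) ≤ ℓ)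
    {a b c d : V} {P : G.Walk a b} (hP : P.IsPath) {Q : G.Walk c d} (hQ : Q.IsPath)
    (hPw : (P.edges.map w).sum ≤ ℓ) (hQw : (Q.edges.map w).sum ≤ ℓ) :
    ((Finset.range P.length).filter fun s => P.getVert s ∈ Q.support ∧
      s(P.getVert s, P.getVert (s + 1)) ∉ Q.edges).card ≤ 64 * k ^ 3 + 1 := by
  by_contra! hlt
  set O := (Finset.range P.length).filter fun s => P.getVert s ∈ Q.support ∧
    s(P.getVert s, P.getVert (s + 1)) ∉ Q.edges with hO
  have hcard : 8 * (k + k) ^ 3 + 2 ≤ O.card := by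
    rw [show 8 * (k + k) ^ 3 = 64 * k ^ 3 by ring]
    omega
  obtain ⟨v, D, hD, hdisj, hE⟩ := exists_disjoint_cycles_of_exits hP hQ (k + k) O
    (fun s hs => by simpa [hO] using hs) hcard
  have hsum := sum_weight_cycles_le w hP hQ hD hdisj hE
  rw [Fin.sum_univ_add] at hsum
  rcases le_total (∑ i : Fin k, ((D (Fin.castAdd k i)).edges.map w).sum)
    (∑ i : Fin k, ((D (Fin.natAdd k i)).edges.map w).sum) with h | h
  · refine hno ⟨_, fun i => D (Fin.castAdd k i), fun i => hD _,
      fun i j hij => hdisj _ _ (by simpa [Fin.ext_iff] using hij), ?_⟩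
    dsimp only
    omega
  · refine hno ⟨_, fun i => D (Fin.natAdd k i), fun i => hD _,
      fun i j hij => hdisj _ _ (by simpa [Fin.ext_iff] using hij), ?_⟩
    dsimp only
    omega

/-- Lists obtained by gluing `N` prescribed lists `g t a b` end to end, starting from `a`. -/
def walkCodes {V T : Type*} [Fintype V] [DecidableEq V] [Fintype T] (g : T → V → V → List V) :
    ℕ → V → Finset (List V)
  | 0, a => {[a]}
  | N + 1, a => Finset.univ.biUnion fun t : T × V =>
      (walkCodes g N t.2).image fun l => (g t.1 a t.2).dropLast ++ l

theorem card_walkCodes_le {V T : Type*} [Fintype V] [DecidableEq V] [Fintype T]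
    (g : T → V → V → List V) (N : ℕ) (a : V) :
    (walkCodes g N a).card ≤ (Fintype.card T * Fintype.card V) ^ N := by
  induction N generalizing a with
  | zero => simp [walkCodes]
  | succ N ih =>
    rw [walkCodes]
    refine Finset.card_biUnion_le.trans ?_
    refine (Finset.sum_le_card_nsmul _ _ ((Fintype.card T * Fintype.card V) ^ N) fun t _ =>
      Finset.card_image_le.trans (ih t.2)).trans ?_
    rw [Finset.card_univ, Fintype.card_prod, smul_eq_mul, pow_succ']

theorem append_mem_walkCodes {V T : Type*} [Fintype V] [DecidableEq V] [Fintype T]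
    {g : T → V → V → List V} {N : ℕ} {a b : V} {l l' : List V} {t : T} (hl : l = g t a b)
    (hl' : l' ∈ walkCodes g N b) : l.dropLast ++ l' ∈ walkCodes g (N + 1) a := by
  subst hl
  exact Finset.mem_biUnion.mpr ⟨(t, b), Finset.mem_univ _, Finset.mem_image.mpr ⟨l', hl', rfl⟩⟩

/-- A walk of cost at least `ℓ` has a first edge at which the cost reaches `ℓ`. -/
theorem SimpleGraph.Walk.exists_eq_append_cons_of_le_cost {V : Type*} {G : SimpleGraph V}
    (cost : Sym2 V → ℕ) {a b : V} (p : G.Walk a b) (ℓ : ℕ) (hℓ : 0 < ℓ)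
    (h : ℓ ≤ (p.edges.map cost).sum) :
    ∃ (x y : V) (q₁ : G.Walk a x) (hxy : G.Adj x y) (q₂ : G.Walk y b),
      p = q₁.append (Walk.cons hxy q₂) ∧ (q₁.edges.map cost).sum < ℓ ∧
        ℓ ≤ (q₁.edges.map cost).sum + cost s(x, y) := by
  induction p generalizing ℓ with
  | nil => simp at h; omega
  | @cons u v w huv p ih =>
    rw [Walk.edges_cons, List.map_cons, List.sum_cons] at h
    by_cases hc : ℓ ≤ cost s(u, v)
    · exact ⟨u, v, Walk.nil, huv, p, rfl, by simpa using hℓ, by simpa using hc⟩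
    · obtain ⟨x, y, q₁, hxy, q₂, rfl, h1, h2⟩ := ih (ℓ - cost s(u, v)) (by omega) (by omega)
      refine ⟨x, y, Walk.cons huv q₁, hxy, q₂, rfl, ?_, ?_⟩ <;>
        rw [Walk.edges_cons, List.map_cons, List.sum_cons] <;> omega

/-- If edges and cheap paths are prescribed by their ends, then every path is glued from a number
of prescribed paths that is linear in its cost. -/
theorem support_mem_walkCodes {V T : Type*} [Fintype V] [DecidableEq V] [Fintype T]
    {G : SimpleGraph V} {g : T → V → V → List V} (cost : Sym2 V → ℕ) {ℓ : ℕ} (hℓ : 0 < ℓ)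
    (hedge : ∀ (a b : V) (p : G.Walk a b), p.length ≤ 1 → ∃ t, p.support = g t a b)
    (hcheap : ∀ (a b : V) (p : G.Walk a b), p.IsPath → (p.edges.map cost).sum < ℓ →
      ∃ t, p.support = g t a b) (r : ℕ) :
    ∀ (a b : V) (p : G.Walk a b), p.IsPath → (p.edges.map cost).sum < (r + 1) * ℓ →
      p.support ∈ walkCodes g (2 * r + 1) a := by
  have hmono : ∀ N a, walkCodes g N a ⊆ walkCodes g (N + 1) a := by
    intro N a l hl
    obtain ⟨t, ht⟩ := hedge a a Walk.nil (by simp)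
    simpa using append_mem_walkCodes ht hl
  have hone : ∀ (a b : V) (p : G.Walk a b), p.IsPath → (p.edges.map cost).sum < ℓ →
      ∀ N, p.support ∈ walkCodes g (N + 1) a := by
    intro a b p hp hc N
    induction N with
    | zero =>
      obtain ⟨t, ht⟩ := hcheap a b p hp hc
      have := append_mem_walkCodes (N := 0) (l' := [b]) ht (by simp [walkCodes])
      have hs := p.support_append_eq_support_dropLast_append (Walk.nil : G.Walk b b)
      rw [Walk.append_nil, Walk.support_nil] at hs
      rwa [← hs] at this
    | succ N ih => exact hmono _ _ ih
  induction r with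
  | zero => exact fun a b p hp hc => hone a b p hp (by simpa using hc) 0
  | succ r ih =>
    intro a b p hp hc
    by_cases hlt : (p.edges.map cost).sum < ℓ
    · exact hone a b p hp hlt _
    · obtain ⟨x, y, q₁, hxy, q₂, rfl, h1, h2⟩ :=
        p.exists_eq_append_cons_of_le_cost cost ℓ hℓ (not_lt.mp hlt)
      rw [Walk.edges_append, Walk.edges_cons, List.map_append, List.map_cons, List.sum_append,
        List.sum_cons] at hc
      have hq₂ := ih y b q₂ hp.of_append_right.of_cons (by
        rw [add_mul, one_mul] at hc
        omega)
      obtain ⟨t₁, ht₁⟩ := hcheap _ _ q₁ hp.of_append_left h1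
      obtain ⟨t₂, ht₂⟩ := hedge x y (Walk.cons hxy Walk.nil) (by simp)
      have := append_mem_walkCodes ht₁ (append_mem_walkCodes ht₂ hq₂)
      rw [Walk.support_append_eq_support_dropLast_append, Walk.support_cons]
      rw [show 2 * (r + 1) + 1 = 2 * r + 1 + 1 + 1 by ring]
      simpa using this

/-- Vertex-disjoint paths do not contain all edges of a cycle. -/
theorem not_isCycle_of_edges_subset_disjoint_paths {V ι : Type*} {G : SimpleGraph V}
    {x y : ι → V} {Q : (i : ι) → G.Walk (x i) (y i)} (hQ : ∀ i, (Q i).IsPath)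
    (hdisj : ∀ i j, i ≠ j → ∀ z, z ∈ (Q i).support → z ∉ (Q j).support) [Finite ι]
    {v : V} {D : G.Walk v v} (hD : D.IsCycle) (hE : ∀ e ∈ D.edges, ∃ i, e ∈ (Q i).edges) :
    False := by
  classical
  have hE' : ∀ a b, s(a, b) ∈ D.edges → ∃ i, ∃ j < (Q i).length,
      s((Q i).getVert j, (Q i).getVert (j + 1)) = s(a, b) := fun a b hab => by
    obtain ⟨i, hi⟩ := hE _ hab
    exact ⟨i, (Walk.mk_mem_edges_iff_exists _).mp hi⟩
  let S : Set ℕ := {j | ∃ i, j < (Q i).length ∧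
    s((Q i).getVert j, (Q i).getVert (j + 1)) ∈ D.edges}
  have hSfin : S.Finite := by
    refine (Set.finite_iUnion fun i => Set.finite_lt_nat (Q i).length).subset ?_
    rintro j ⟨i, hj, -⟩
    exact Set.mem_iUnion.mpr ⟨i, hj⟩
  have hSne : S.Nonempty := by
    have hmem := D.mk_start_snd_mem_edges hD.not_nil
    obtain ⟨i, j, hj, he⟩ := hE' _ _ hmem
    exact ⟨j, i, hj, he ▸ hmem⟩
  obtain ⟨j, ⟨i, hj, hjD⟩, hmax⟩ := Set.exists_max_image S id hSfin hSne
  have hnbr : ∀ z, s((Q i).getVert (j + 1), z) ∈ D.edges → z = (Q i).getVert j := by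
    intro z hz
    obtain ⟨i', j', hj', he⟩ := hE' _ _ hz
    have hj'S : j' ≤ j := hmax j' ⟨i', hj', he ▸ hz⟩
    have hii : i' = i := by
      by_contra hne
      rw [Sym2.eq_iff] at he
      refine hdisj i' i hne ((Q i).getVert (j + 1)) ?_ ((Q i).getVert_mem_support _)
      rcases he with ⟨h, -⟩ | ⟨-, h⟩ <;> rw [← h] <;> exact (Q i').getVert_mem_support _
    subst hii
    rw [Sym2.eq_iff] at he
    rcases he with ⟨h, -⟩ | ⟨h, h'⟩
    · have := (hQ i').getVert_injOn (show j' ≤ _ by omega) (show j + 1 ≤ _ by omega) h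
      omega
    · have := (hQ i').getVert_injOn (show j' + 1 ≤ _ by omega) (show j + 1 ≤ _ by omega) h'
      obtain rfl : j' = j := by omega
      exact h.symm
  have hx : (Q i).getVert (j + 1) ∈ D.support := D.snd_mem_support_of_mem_edges hjD
  have hrot := hD.rotate hx
  have hmem : ∀ e, e ∈ (D.rotate _ hx).edges → e ∈ D.edges := fun e he =>
    (D.rotate_edges _ hx).mem_iff.mp he
  refine hrot.snd_ne_penultimate ?_
  have h1 := hnbr _ (hmem _ (Walk.mk_start_snd_mem_edges hrot.not_nil))
  have h2 := hmem _ (Walk.mk_penultimate_end_mem_edges hrot.not_nil)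
  rw [Sym2.eq_swap] at h2
  exact h1.trans (hnbr _ h2).symm

/-- A maximal packing of cycles of weight at most `ℓ / k`, with one edge removed from each cycle. -/
theorem exists_disjoint_paths_meeting_light_cycles {V : Type*} {G : SimpleGraph V}
    (w : Sym2 V → ℕ) {k ℓ : ℕ}
    (hno : ¬ ∃ (v : Fin k → V) (D : (i : Fin k) → G.Walk (v i) (v i)),
      (∀ i, (D i).IsCycle) ∧
      (∀ i j, i ≠ j → ∀ x, x ∈ (D i).support → x ∉ (D j).support) ∧
      (∑ i, ((D i).edges.map w).sum) ≤ ℓ) :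
    ∃ m < k, ∃ (x y : Fin m → V) (Q : (i : Fin m) → G.Walk (x i) (y i)), (∀ i, (Q i).IsPath) ∧
      (∀ i j, i ≠ j → ∀ z, z ∈ (Q i).support → z ∉ (Q j).support) ∧
      (∀ i, ((Q i).edges.map w).sum ≤ ℓ) ∧
      ∀ (v : V) (D : G.Walk v v), D.IsCycle → k * (D.edges.map w).sum ≤ ℓ →
        ∃ i, ∃ z ∈ D.support, z ∈ (Q i).support := by
  classical
  let packs : ℕ → Prop := fun m => ∃ (v : Fin m → V) (D : (i : Fin m) → G.Walk (v i) (v i)),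
    (∀ i, (D i).IsCycle) ∧ (∀ i j, i ≠ j → ∀ x, x ∈ (D i).support → x ∉ (D j).support) ∧
    ∀ i, k * ((D i).edges.map w).sum ≤ ℓ
  have hk : ¬ packs k := by
    rintro ⟨v, D, hD, hdisj, hw⟩
    refine hno ⟨v, D, hD, hdisj, ?_⟩
    rcases Nat.eq_zero_or_pos k with rfl | hk
    · simp
    · refine Nat.le_of_mul_le_mul_left ?_ hk
      rw [Finset.mul_sum]
      simpa using Finset.sum_le_card_nsmul Finset.univ _ ℓ fun i _ => hw i
  have h0 : packs 0 := ⟨Fin.elim0, fun i => i.elim0, fun i => i.elim0, fun i => i.elim0,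
    fun i => i.elim0⟩
  obtain ⟨m, hmk, ⟨v, D, hD, hdisj, hw⟩, hmax⟩ : ∃ m < k, packs m ∧ ¬ packs (m + 1) := by
    by_contra! hcon
    have : ∀ m ≤ k, packs m := by
      intro m
      induction m with
      | zero => exact fun _ => h0
      | succ m ih => exact fun hm => hcon m (by omega) (ih (by omega))
    exact hk (this k le_rfl)
  have htail : ∀ i z, z ∈ (D i).tail.support ↔ z ∈ (D i).support := by
    intro i z
    rw [Walk.support_tail_of_not_nil _ (hD i).not_nil, Walk.mem_support_iff]
    constructor
    · exact Or.inr
    · rintro (rfl | h)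
      · exact Walk.end_mem_tail_support (hD i).not_nil
      · exact h
  refine ⟨m, hmk, _, _, fun i => (D i).tail, fun i => (hD i).isPath_tail, ?_, ?_, ?_⟩
  · intro i j hij z
    rw [htail, htail]
    exact hdisj i j hij z
  · intro i
    have h1 : ((D i).tail.edges.map w).sum ≤ ((D i).edges.map w).sum := by
      rw [Walk.edges_tail]
      exact ((List.tail_sublist _).map w).sum_le_sum fun _ _ => Nat.zero_le _
    exact h1.trans ((Nat.le_mul_of_pos_left _ (by omega)).trans (hw i))
  · intro u C hC hCw
    by_contra! hcon
    refine hmax ⟨Fin.cons u v, Fin.cons C D, ?_, ?_, ?_⟩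
    · exact Fin.cases hC hD
    · have hCD : ∀ i z, z ∈ C.support → z ∉ (D i).support := fun i z hz =>
        fun h => hcon i z hz ((htail i z).mpr h)
      intro i j
      refine Fin.cases ?_ (fun i => ?_) i <;> refine Fin.cases ?_ (fun j => ?_) j
      · exact fun h => absurd rfl h
      · exact fun _ z hz => hCD j z hz
      · exact fun _ z hz hz' => hCD i z hz' hz
      · exact fun hij => hdisj i j fun h => hij (by rw [h])
    · exact Fin.cases hCw hw

/-- Two distinct paths with the same ends contain a cycle in their union. -/
theorem exists_isCycle_of_isPath_of_ne {V : Type*} [DecidableEq V] {G : SimpleGraph V}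
    (w : Sym2 V → ℕ) {a b : V} {p q : G.Walk a b} (hp : p.IsPath) (hq : q.IsPath) (hne : p ≠ q) :
    ∃ (v : V) (D : G.Walk v v), D.IsCycle ∧ (∀ e ∈ D.edges, e ∈ p.edges ∨ e ∈ q.edges) ∧
      (∀ z ∈ D.support, z ∈ p.support ∨ z ∈ q.support) ∧
      (D.edges.map w).sum ≤ (p.edges.map w).sum + (q.edges.map w).sum := by
  obtain ⟨u, v, p', q', hp', hq', hD⟩ := hp.exists_isCycle_of_ne hq hne
  have hE : ∀ e ∈ (p'.append q'.reverse).edges, e ∈ p.edges ∨ e ∈ q.edges := by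
    intro e he
    rw [Walk.edges_append, List.mem_append, Walk.edges_reverse, List.mem_reverse] at he
    exact he.imp (fun h => hp'.edges_subset h) fun h => hq'.edges_subset h
  refine ⟨u, _, hD, hE, ?_, ?_⟩
  · intro z hz
    rw [Walk.mem_support_append_iff, Walk.support_reverse, List.mem_reverse] at hz
    exact hz.imp (fun h => hp'.support_subset h) fun h => hq'.support_subset h
  · simpa using sum_weight_cycles_le w hp hq (K := 1) (v := fun _ => u) (fun _ => hD)
      (fun i j hij => absurd (Subsingleton.elim i j) hij) fun _ => hE

/-- If every edge outside `E` avoids the vertex set `X`, and every edge in `E` lies inside `X`, then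
a walk either uses only edges of `E` or avoids `X`. -/
theorem SimpleGraph.Walk.edges_mem_or_support_notMem {V : Type*} {G : SimpleGraph V} {X : Set V}
    {E : Set (Sym2 V)} (hEX : ∀ e ∈ E, ∀ x ∈ e, x ∈ X) {a b : V} (p : G.Walk a b)
    (hp : ∀ e ∈ p.edges, e ∉ E → ∀ x ∈ e, x ∉ X) :
    (∀ e ∈ p.edges, e ∈ E) ∨ ∀ z ∈ p.support, z ∉ X := by
  suffices h : (a ∈ X → ∀ e ∈ p.edges, e ∈ E) ∧ (a ∉ X → ∀ z ∈ p.support, z ∉ X) by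
    by_cases ha : a ∈ X
    · exact Or.inl (h.1 ha)
    · exact Or.inr (h.2 ha)
  induction p with
  | nil => simp
  | @cons u v b huv p ih =>
    simp only [Walk.edges_cons, List.forall_mem_cons, Walk.support_cons] at hp ⊢
    obtain ⟨ih1, ih2⟩ := ih hp.2
    have huE : u ∈ X → s(u, v) ∈ E := fun hu => by
      by_contra h
      exact hp.1 h u (Sym2.mem_mk_left u v) hu
    refine ⟨fun hu => ⟨huE hu, ih1 (hEX _ (huE hu) v (Sym2.mem_mk_right u v))⟩, fun hu => ⟨hu, ?_⟩⟩
    exact ih2 (hp.1 (fun h => hu (hEX _ h u (Sym2.mem_mk_left u v))) v (Sym2.mem_mk_right u v))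

/-- If `G` has no `k` vertex-disjoint cycles of total weight at most `ℓ`, then a path `P` of weight
at most `ℓ` has a bounded number of edges that meet another such path `Q` without being in `Q`. -/
theorem card_edges_meeting_le {V : Type*} [DecidableEq V] {G : SimpleGraph V} (w : Sym2 V → ℕ)
    {k ℓ : ℕ}
    (hno : ¬ ∃ (v : Fin k → V) (D : (i : Fin k) → G.Walk (v i) (v i)),
      (∀ i, (D i).IsCycle) ∧
      (∀ i j, i ≠ j → ∀ x, x ∈ (D i).support → x ∉ (D j).support) ∧
      (∑ i, ((D i).edges.map w).sum) ≤ ℓ)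
    {a b c d : V} {P : G.Walk a b} (hP : P.IsPath) {Q : G.Walk c d} (hQ : Q.IsPath)
    (hPw : (P.edges.map w).sum ≤ ℓ) (hQw : (Q.edges.map w).sum ≤ ℓ) :
    (P.edges.toFinset.filter fun e => e ∉ Q.edges ∧ ∃ z ∈ Q.support, z ∈ e).card ≤
      2 * (64 * k ^ 3 + 1) := by
  have h1 := card_exits_le w hno hP hQ hPw hQw
  have h2 := card_exits_le w hno hP.reverse hQ (by simpa [List.sum_reverse] using hPw) hQw
  rw [two_mul]
  refine le_trans ?_ ((Finset.card_union_le _ _).trans (add_le_add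
    ((Finset.card_image_le (f := fun s => s(P.getVert s, P.getVert (s + 1)))).trans h1)
    ((Finset.card_image_le
      (f := fun s => s(P.reverse.getVert s, P.reverse.getVert (s + 1)))).trans h2)))
  refine Finset.card_le_card fun e he => ?_
  rw [Finset.mem_filter, List.mem_toFinset] at he
  obtain ⟨heP, heQ, z, hzQ, hze⟩ := he
  obtain ⟨y, rfl⟩ := Sym2.mem_iff_exists.mp hze
  simp only [Finset.mem_union, Finset.mem_image, Finset.mem_filter, Finset.mem_range]
  obtain ⟨s, hs, hse⟩ := (Walk.mk_mem_edges_iff_exists _).mp heP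
  rcases Sym2.eq_iff.mp hse with ⟨hz, -⟩ | ⟨hy, hz⟩
  · exact Or.inl ⟨s, ⟨hs, by rwa [hz], by rwa [hse]⟩, hse⟩
  · have e1 : P.reverse.getVert (P.length - (s + 1)) = z := by
      rw [Walk.getVert_reverse, ← hz]
      congr 1
      omega
    have e2 : P.reverse.getVert (P.length - (s + 1) + 1) = y := by
      rw [Walk.getVert_reverse, ← hy]
      congr 1
      omega
    refine Or.inr ⟨P.length - (s + 1), ⟨by rw [Walk.length_reverse]; omega, ?_, ?_⟩, ?_⟩
    · rwa [e1]
    · rwa [e1, e2]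
    · rw [e1, e2]

/-- If a property determines walks by their ends, then their supports are prescribed by the ends. -/
theorem exists_support_eq_of_unique {V T : Type*} {G : SimpleGraph V}
    (piece : T → (a b : V) → G.Walk a b → Prop)
    (huniq : ∀ t a b p q, piece t a b p → piece t a b q → p = q) :
    ∃ g : T → V → V → List V, ∀ t a b p, piece t a b p → p.support = g t a b := by
  classical
  refine ⟨fun t a b => if h : ∃ p, piece t a b p then h.choose.support else [],
    fun t a b p hp => ?_⟩
  have h : ∃ p, piece t a b p := ⟨p, hp⟩
  simp only [dif_pos h]
  rw [huniq t a b p _ hp h.choose_spec]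

/-- If `G` has no `k` vertex-disjoint cycles of total weight at most `ℓ`, then all paths of weight
at most `ℓ` are glued from boundedly many paths out of three families that contain at most one path
for each pair of ends. -/
theorem exists_support_mem_walkCodes {V : Type*} [Fintype V] [DecidableEq V] {G : SimpleGraph V}
    (w : Sym2 V → ℕ) {k ℓ : ℕ} (hℓ : 0 < ℓ)
    (hno : ¬ ∃ (v : Fin k → V) (D : (i : Fin k) → G.Walk (v i) (v i)),
      (∀ i, (D i).IsCycle) ∧
      (∀ i j, i ≠ j → ∀ x, x ∈ (D i).support → x ∉ (D j).support) ∧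
      (∑ i, ((D i).edges.map w).sum) ≤ ℓ) :
    ∃ m < k, ∃ g : Fin 3 → V → V → List V, ∀ (a b : V) (p : G.Walk a b), p.IsPath →
      (p.edges.map w).sum ≤ ℓ →
        p.support ∈ walkCodes g (2 * (m * (2 * (64 * k ^ 3 + 1)) + 2 * k) + 1) a := by
  obtain ⟨m, hmk, x, y, Q, hQ, hdisj, hQw, hmeet⟩ :=
    exists_disjoint_paths_meeting_light_cycles w hno
  set E : Set (Sym2 V) := {e | ∃ i, e ∈ (Q i).edges} with hE
  set X : Set V := {z | ∃ i, z ∈ (Q i).support} with hX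
  have hEX : ∀ e ∈ E, ∀ z ∈ e, z ∈ X := by
    rintro e ⟨i, hi⟩ z hz
    obtain ⟨y, rfl⟩ := Sym2.mem_iff_exists.mp hz
    exact ⟨i, (Q i).fst_mem_support_of_mem_edges hi⟩
  let piece : Fin 3 → (a b : V) → G.Walk a b → Prop := fun t a b p =>
    ![p.length ≤ 1, p.IsPath ∧ ∀ e ∈ p.edges, e ∈ E,
      p.IsPath ∧ (∀ z ∈ p.support, z ∉ X) ∧ 2 * k * (p.edges.map w).sum < ℓ] t
  obtain ⟨g, hg⟩ := exists_support_eq_of_unique piece (by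
    intro t a b p q hp hq
    by_contra hne
    fin_cases t
    · exact hne (Walk.eq_of_length_le_one hp hq)
    · obtain ⟨v, D, hD, hDE, -, -⟩ := exists_isCycle_of_isPath_of_ne w hp.1 hq.1 hne
      exact not_isCycle_of_edges_subset_disjoint_paths hQ hdisj hD fun e he =>
        (hDE e he).elim (hp.2 e) (hq.2 e)
    · obtain ⟨hp, hpX, hpw⟩ := hp
      obtain ⟨hq, hqX, hqw⟩ := hq
      obtain ⟨v, D, hD, -, hDX, hDw⟩ := exists_isCycle_of_isPath_of_ne w hp hq hne
      obtain ⟨i, z, hz, hzi⟩ := hmeet v D hD (by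
        have := Nat.mul_le_mul_left k hDw
        nlinarith)
      exact (hDX z hz).elim (fun h => hpX z h ⟨i, hzi⟩) fun h => hqX z h ⟨i, hzi⟩)
  classical
  let bad : Sym2 V → Prop := fun e => e ∉ E ∧ ∃ z ∈ e, z ∈ X
  let cost : Sym2 V → ℕ := fun e => (if bad e then ℓ else 0) + 2 * k * w e
  refine ⟨m, hmk, g, fun a b p hp hpw => support_mem_walkCodes cost hℓ
    (fun a b p hp => ⟨0, hg 0 a b p hp⟩) ?_ _ a b p hp ?_⟩
  · intro a b p hp hc
    have hgood : ∀ e ∈ p.edges, ¬ bad e := fun e he hbad => by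
      have h1 := List.single_le_sum (fun _ _ => Nat.zero_le _) _
        (List.mem_map_of_mem (f := cost) he)
      simp only [cost, if_pos hbad] at h1 hc
      omega
    rcases p.edges_mem_or_support_notMem hEX
      (fun e he heE z hz hzX => hgood e he ⟨heE, z, hz, hzX⟩) with h | h
    · exact ⟨1, hg 1 a b p ⟨hp, h⟩⟩
    · refine ⟨2, hg 2 a b p ⟨hp, h, lt_of_le_of_lt ?_ hc⟩⟩
      rw [← List.sum_map_mul_left]
      exact List.sum_le_sum fun e _ => Nat.le_add_left _ _
  · have hbad : (p.edges.toFinset.filter bad).card ≤ m * (2 * (64 * k ^ 3 + 1)) := by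
      have hsub : p.edges.toFinset.filter bad ⊆ Finset.univ.biUnion fun i : Fin m =>
          p.edges.toFinset.filter fun e => e ∉ (Q i).edges ∧ ∃ z ∈ (Q i).support, z ∈ e := by
        intro e he
        obtain ⟨hep, heE, z, hze, i, hzi⟩ := Finset.mem_filter.mp he
        exact Finset.mem_biUnion.mpr ⟨i, Finset.mem_univ i, Finset.mem_filter.mpr
          ⟨hep, fun h => heE ⟨i, h⟩, z, hzi, hze⟩⟩
      refine (Finset.card_le_card hsub).trans (Finset.card_biUnion_le.trans ?_)
      simpa using Finset.sum_le_card_nsmul Finset.univ _ (2 * (64 * k ^ 3 + 1)) fun i _ =>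
        card_edges_meeting_le w hno hp (hQ i) hpw (hQw i)
    have hsum : (p.edges.map cost).sum =
        (p.edges.toFinset.filter bad).card * ℓ + 2 * k * (p.edges.map w).sum := by
      rw [← List.sum_toFinset cost hp.isTrail.edges_nodup,
        ← List.sum_toFinset w hp.isTrail.edges_nodup, Finset.sum_add_distrib, ← Finset.mul_sum,
        ← Finset.sum_filter, Finset.sum_const, smul_eq_mul]
    rw [hsum]
    nlinarith [Nat.mul_le_mul_right ℓ hbad, Nat.mul_le_mul_left (2 * k) hpw]

theorem code_exponent_le {m k : ℕ} (h : m < k) :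
    1 + 3 * (2 * (m * (2 * (64 * k ^ 3 + 1)) + 2 * k) + 1) ≤ 256 * k ^ 4 + 1024 * k ^ 5 := by
  obtain ⟨j, rfl⟩ : ∃ j, k = j + 1 := ⟨k - 1, by omega⟩
  have h1 : m * (2 * (64 * (j + 1) ^ 3 + 1)) ≤ j * (2 * (64 * (j + 1) ^ 3 + 1)) :=
    Nat.mul_le_mul_right _ (by omega)
  have h2 : 1 + 3 * (2 * (j * (2 * (64 * (j + 1) ^ 3 + 1)) + 2 * (j + 1)) + 1) ≤
      256 * (j + 1) ^ 4 + 1024 * (j + 1) ^ 5 := by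
    ring_nf
    nlinarith [Nat.zero_le j, Nat.zero_le (j ^ 2), Nat.zero_le (j ^ 3), Nat.zero_le (j ^ 4),
      Nat.zero_le (j ^ 5)]
  omega
/-- Let `(G, w)` be a weighted graph (positive integer edge weights) on
`n ≥ 2` vertices and `k ≥ 1`.  If `G` does not contain `k` pairwise vertex-disjoint cycles of
total weight at most `ℓ`, then the number of nontrivial paths of weight at most `ℓ` in `G` is
at most `n^(256k⁴) · n^(1024k⁵) = n^(256k⁴ + 1024k⁵)`.  Paths are counted as undirected
objects: a path is identified with the unordered pair `s(support, reversed support)` of its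
vertex sequences, so a path and its reverse are counted once. -/
theorem stmt_10 {V : Type*} [Fintype V] [DecidableEq V]
    (G : SimpleGraph V) (w : Sym2 V → ℕ)
    (hw : ∀ e ∈ G.edgeSet, 0 < w e)
    (hn : 2 ≤ Fintype.card V) (k ℓ : ℕ) (hk : 1 ≤ k)
    (hno : ¬ ∃ (v : Fin k → V) (D : (i : Fin k) → G.Walk (v i) (v i)),
      (∀ i, (D i).IsCycle) ∧
      (∀ i j, i ≠ j → ∀ x, x ∈ (D i).support → x ∉ (D j).support) ∧
      (∑ i, ((D i).edges.map w).sum) ≤ ℓ) :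
    Set.ncard {q : Sym2 (List V) |
        ∃ (a b : V) (p : G.Walk a b), p.IsPath ∧ 0 < p.length ∧
          (p.edges.map w).sum ≤ ℓ ∧ q = s(p.support, p.support.reverse)} ≤
      Fintype.card V ^ (256 * k ^ 4 + 1024 * k ^ 5) := by
  classical
  rcases Nat.eq_zero_or_pos ℓ with rfl | hℓ
  · refine le_trans (le_of_eq ?_) (Nat.zero_le _)
    refine (congrArg Set.ncard (Set.eq_empty_of_forall_notMem ?_)).trans (Set.ncard_empty _)
    rintro q ⟨a, b, p, -, hlen, hpw, -⟩
    cases p with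
    | nil => simp at hlen
    | cons h p =>
      have := hw _ (G.mem_edgeSet.mpr h)
      simp only [Walk.edges_cons, List.map_cons, List.sum_cons] at hpw
      omega
  obtain ⟨m, hmk, g, hg⟩ := exists_support_mem_walkCodes w hℓ hno
  set N := 2 * (m * (2 * (64 * k ^ 3 + 1)) + 2 * k) + 1 with hN
  let codes : Finset (Sym2 (List V)) :=
    (Finset.univ.biUnion fun a => walkCodes g N a).image fun l => s(l, l.reverse)
  have hcodes : codes.card ≤ Fintype.card V * (3 * Fintype.card V) ^ N := by
    refine Finset.card_image_le.trans (Finset.card_biUnion_le.trans ?_)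
    simpa using Finset.sum_le_card_nsmul Finset.univ _ ((3 * Fintype.card V) ^ N) fun a _ => by
      simpa using card_walkCodes_le g N a
  refine le_trans (Set.ncard_le_ncard (t := (codes : Set (Sym2 (List V)))) ?_
    codes.finite_toSet) ?_
  · rintro q ⟨a, b, p, hp, -, hpw, rfl⟩
    exact Finset.mem_coe.mpr (Finset.mem_image.mpr ⟨p.support,
      Finset.mem_biUnion.mpr ⟨a, Finset.mem_univ a, hg a b p hp hpw⟩, rfl⟩)
  · rw [Set.ncard_coe_finset]
    calc codes.card ≤ Fintype.card V * (3 * Fintype.card V) ^ N := hcodes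
      _ ≤ Fintype.card V * (Fintype.card V ^ 3) ^ N := by
        gcongr
        rw [pow_succ]
        exact Nat.mul_le_mul_right _ (by nlinarith)
      _ = Fintype.card V ^ (1 + 3 * N) := by ring
      _ ≤ _ := Nat.pow_le_pow_right (by omega) (code_exponent_le hmk)
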